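/- (Improved discrete fractional Grönwall inequality.) Let 0 < α < 1, ν ∈ [0,1/2), and let the kernels A^{(n,ν)}_{n−k} on a mesh 0 = t_0 < ⋯ < t_N = T satisfy assumptions A1, A2 (with constant π_A) and A3 (with step-ratio bound ρ). Let (ξ^n)_{n=1}^N, (η^n)_{n=1}^N and (λ_l)_{l=0}^{N−1} be nonnegative sequences, let Λ ≥ Σ_{l=0}^{N−1} λ_l, and assume τ := max_k τ_k ≤ (2 π_A Γ(2−α) Λ)^{−1/α}. If a nonnegative sequence (v^k)_{k=0}^N satisfies Σ_{k=1}^n A^{(n,ν)}_{n−k} ((v^k)² − (v^{k−1})²) ≤ Σ_{k=1}^n λ_{n−k} (v^{k−ν})² + v^{n−ν} ξ^n + (η^n)² for all 1 ≤ n ≤ N, then for all 1 ≤ n ≤ N: v^n ≤ 2 E_α(2 max{1,ρ} π_A Λ t_n^α) ( v^0 + max_{1≤k≤n} Σ_{j=1}^k P^{(k,ν)}_{k−j} ξ^j + √(π_A Γ(1−α)) max_{1≤k≤n} { t_k^{α/2} η^k } ). -/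

import Mathlib

section Aux
open MeasureTheory Set

lemma aux_gamma_lower (x M : ℝ) (hx : 0 ≤ x) (hM : 0 < M) :
    M ^ x * Real.exp (-M) ≤ Real.Gamma (1 + x) := by
  rw [Real.Gamma_eq_integral (by linarith)]
  have hint := Real.GammaIntegral_convergent (s := 1 + x) (by linarith)
  calc M ^ x * Real.exp (-M) = ∫ s in Ioi M, M ^ x * Real.exp (-s) := by
        rw [integral_const_mul, integral_exp_neg_Ioi]
    _ ≤ ∫ s in Ioi M, Real.exp (-s) * s ^ (1 + x - 1) := by
        apply setIntegral_mono_on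
        · exact (integrableOn_exp_neg_Ioi M).const_mul _
        · exact hint.mono_set (Ioi_subset_Ioi hM.le)
        · exact measurableSet_Ioi
        · intro s hs
          rw [mul_comm, add_sub_cancel_left]
          have : M ^ x ≤ s ^ x := Real.rpow_le_rpow hM.le (le_of_lt hs) hx
          gcongr
    _ ≤ _ := by
        apply setIntegral_mono_set hint
        · filter_upwards [ae_restrict_mem measurableSet_Ioi] with s hs
          have : (0:ℝ) < s := hs
          simp only [Pi.zero_apply]
          positivity
        · exact (Ioi_subset_Ioi hM.le).eventuallyLE

lemma aux_ml_summable (α x : ℝ) (hα : 0 < α) (hx : 0 ≤ x) :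
    Summable (fun i : ℕ => x ^ i / Real.Gamma (1 + (i:ℝ) * α)) := by
  set y := 2 * x + 1 with hy
  have hy0 : 0 < y := by linarith
  set M := y ^ (1/α) with hM
  have hM0 : 0 < M := by positivity
  have hMα : M ^ α = y := by
    rw [hM, ← Real.rpow_mul hy0.le]; field_simp; simp
  have hgeo : Summable (fun i : ℕ => Real.exp M * (x / y) ^ i) := by
    apply Summable.mul_left
    apply summable_geometric_of_lt_one (by positivity)
    rw [div_lt_one hy0]; linarith
  refine Summable.of_nonneg_of_le ?_ ?_ hgeo
  · intro i
    have : 0 < Real.Gamma (1 + (i:ℝ) * α) := Real.Gamma_pos_of_pos (by positivity)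
    positivity
  · intro i
    have h := aux_gamma_lower ((i:ℝ) * α) M (by positivity) hM0
    have h2 : M ^ ((i:ℝ) * α) = y ^ i := by
      rw [mul_comm, Real.rpow_mul hM0.le, hMα, Real.rpow_natCast]
    rw [h2] at h
    calc x ^ i / Real.Gamma (1 + (i:ℝ) * α) ≤ x ^ i / (y ^ i * Real.exp (-M)) := by
          gcongr
      _ = _ := by
          rw [Real.exp_neg, div_pow]; field_simp

lemma aux_beta (α β a : ℝ) (hα1 : α < 1) (hβ : 0 < β) (ha : 0 < a) :
    ∫ x in (0:ℝ)..a, (a - x) ^ (-α) * x ^ (β - 1) =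
      a ^ (β - α) * (Real.Gamma β * Real.Gamma (1 - α) / Real.Gamma (1 + β - α)) := by
  have h1 := Complex.betaIntegral_scaled (β : ℂ) ((1 - α : ℝ) : ℂ) ha
  have h2 := Complex.Gamma_mul_Gamma_eq_betaIntegral (s := (β:ℂ)) (t := ((1 - α : ℝ) : ℂ))
    (by simpa using hβ) (by simpa using hα1)
  have h3 : ∫ x in (0:ℝ)..a, (x : ℂ) ^ ((β:ℂ) - 1) * ((a : ℂ) - x) ^ (((1 - α : ℝ):ℂ) - 1)
      = ((∫ x in (0:ℝ)..a, (a - x) ^ (-α) * x ^ (β - 1) : ℝ) : ℂ) := by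
    rw [← intervalIntegral.integral_ofReal]
    apply intervalIntegral.integral_congr
    intro x hx
    rw [uIcc_of_le ha.le] at hx
    simp only
    rw [Complex.ofReal_mul, Complex.ofReal_cpow (by linarith [hx.2]), Complex.ofReal_cpow hx.1,
      mul_comm]
    push_cast
    congr 2
    ring
  rw [h3] at h1
  have hg : (0:ℝ) < Real.Gamma (1 + β - α) := Real.Gamma_pos_of_pos (by linarith)
  have e : (β:ℂ) + ((1 - α : ℝ) : ℂ) = ((1 + β - α : ℝ) : ℂ) := by push_cast; ring
  have e2 : ((1 + β - α : ℝ) : ℂ) - 1 = ((β - α : ℝ) : ℂ) := by push_cast; ring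
  rw [e, Complex.Gamma_ofReal, Complex.Gamma_ofReal, Complex.Gamma_ofReal] at h2
  have h4 : Complex.betaIntegral (β : ℂ) ((1 - α : ℝ) : ℂ) =
     ((Real.Gamma β * Real.Gamma (1 - α) / Real.Gamma (1 + β - α) : ℝ) : ℂ) := by
    have : (Real.Gamma (1 + β - α) : ℂ) ≠ 0 := by exact_mod_cast hg.ne'
    rw [Complex.ofReal_div, Complex.ofReal_mul, h2]; field_simp
  rw [e, e2, h4, ← Complex.ofReal_cpow ha.le, ← Complex.ofReal_mul] at h1
  exact_mod_cast h1

lemma aux_beta_int (α β a : ℝ) (hα1 : α < 1) (hβ : 0 < β) (ha : 0 < a) :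
    IntervalIntegrable (fun x => (a - x) ^ (-α) * x ^ (β - 1)) volume 0 a := by
  apply intervalIntegral.intervalIntegrable_of_integral_ne_zero
  rw [aux_beta α β a hα1 hβ ha]
  have := Real.Gamma_pos_of_pos (show 0 < 1 + β - α by linarith)
  have := Real.Gamma_pos_of_pos (show 0 < 1 - α by linarith)
  have := Real.Gamma_pos_of_pos hβ
  positivity

lemma aux_f_int (α T a b : ℝ) (hα1 : α < 1) :
    IntervalIntegrable (fun x => (T - x) ^ (-α)) volume a b := by
  have := (intervalIntegral.intervalIntegrable_rpow' (a := T - a) (b := T - b) (r := -α)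
    (by linarith)).comp_sub_left T
  simpa using this

lemma aux_f_nonneg (α T a b : ℝ) (hab : a ≤ b) (hbT : b ≤ T) :
    0 ≤ ∫ x in a..b, (T - x) ^ (-α) := by
  apply intervalIntegral.integral_nonneg hab
  intro u hu
  exact Real.rpow_nonneg (by linarith [hu.2]) _

lemma aux_cell2 (α β T a b : ℝ) (hα1 : α < 1) (hβ : 1 ≤ β) (ha : 0 ≤ a)
    (hab : a < b) (hbT : b ≤ T) :
    ∫ x in a..b, (T - x) ^ (-α) * x ^ (β - 1) ≤
      (∫ x in a..b, (T - x) ^ (-α)) * b ^ (β - 1) := by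
  rw [← intervalIntegral.integral_mul_const]
  apply intervalIntegral.integral_mono_on hab.le
  · apply (aux_beta_int α β T hα1 (by linarith) (by linarith)).mono_set
    rw [uIcc_of_le hab.le, uIcc_of_le (by linarith)]
    exact Icc_subset_Icc ha hbT
  · exact (aux_f_int α T a b hα1).mul_const _
  · intro x hx
    have h1 : 0 ≤ (T - x) ^ (-α) := Real.rpow_nonneg (by linarith [hx.2]) _
    have h2 : x ^ (β - 1) ≤ b ^ (β - 1) :=
      Real.rpow_le_rpow (by linarith [hx.1]) hx.2 (by linarith)
    gcongr

lemma aux_mvt (β a b : ℝ) (hβ : 0 < β) (ha : 0 ≤ a) (hab : a < b) :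
    ∃ c ∈ Ioo a b, c ^ (β - 1) = (b ^ β - a ^ β) / β / (b - a) := by
  obtain ⟨c, hc, h⟩ := exists_hasDerivAt_eq_slope (fun x : ℝ => x ^ β)
    (fun x => β * x ^ (β - 1)) hab
    (Continuous.continuousOn (Real.continuous_rpow_const hβ.le))
    (fun x hx => Real.hasDerivAt_rpow_const (Or.inl (by linarith [hx.1])))
  refine ⟨c, hc, ?_⟩
  rw [div_right_comm, ← h]; field_simp

lemma aux_cell1 (α β T a b : ℝ) (hα0 : 0 < α) (hα1 : α < 1) (hβ0 : 0 < β) (hβ : β ≤ 1) (ha : 0 ≤ a)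
    (hab : a < b) (hbT : b ≤ T) :
    ∫ x in a..b, (T - x) ^ (-α) * x ^ (β - 1) ≤
      (∫ x in a..b, (T - x) ^ (-α)) * ((b ^ β - a ^ β) / β / (b - a)) := by
  obtain ⟨c, hc, hm⟩ := aux_mvt β a b hβ0 ha hab
  rw [← hm]
  have hfi := aux_f_int α T a b hα1
  have hgi : IntervalIntegrable (fun x : ℝ => x ^ (β - 1)) volume a b :=
    intervalIntegral.intervalIntegrable_rpow' (by linarith)
  have hfgi : IntervalIntegrable (fun x => (T - x) ^ (-α) * x ^ (β - 1)) volume a b := by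
    apply (aux_beta_int α β T hα1 (by linarith) (by linarith)).mono_set
    rw [uIcc_of_le hab.le, uIcc_of_le (by linarith)]
    exact Icc_subset_Icc ha hbT
  have hG : ∫ x in a..b, x ^ (β - 1) = c ^ (β - 1) * (b - a) := by
    rw [integral_rpow (Or.inl (by linarith)), hm]
    have : b - a ≠ 0 := by linarith
    simp only [sub_add_cancel]
    field_simp
  set m := c ^ (β - 1) with hmdef
  set F := (T - c) ^ (-α) with hF
  have key : ∫ x in a..b, (T - x) ^ (-α) * x ^ (β - 1) ≤
      ∫ x in a..b, ((T - x) ^ (-α) * m + F * (x ^ (β - 1) - m)) := by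
    apply intervalIntegral.integral_mono_on_of_le_Ioo hab.le hfgi
    · exact (hfi.mul_const _).add ((hgi.sub intervalIntegrable_const).const_mul _)
    · intro x hx
      have hc1 := hc.1
      have hc2 := hc.2
      have hx1 := hx.1
      have hx2 := hx.2
      rcases le_total x c with h | h
      · have h1 : (T - x) ^ (-α) ≤ F :=
          Real.rpow_le_rpow_of_nonpos (by linarith) (by linarith) (by linarith)
        have h2 : m ≤ x ^ (β - 1) :=
          Real.rpow_le_rpow_of_nonpos (by linarith) (by linarith) (by linarith)
        nlinarith
      · have h1 : F ≤ (T - x) ^ (-α) :=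
          Real.rpow_le_rpow_of_nonpos (by linarith) (by linarith) (by linarith)
        have h2 : x ^ (β - 1) ≤ m :=
          Real.rpow_le_rpow_of_nonpos (by linarith) (by linarith) (by linarith)
        nlinarith
  rw [intervalIntegral.integral_add (hfi.mul_const _)
    ((hgi.sub intervalIntegrable_const).const_mul _),
    intervalIntegral.integral_mul_const, intervalIntegral.integral_const_mul,
    intervalIntegral.integral_sub hgi intervalIntegrable_const, hG,
    intervalIntegral.integral_const, smul_eq_mul] at key
  linarith

lemma aux_mono (N : ℕ) (t : ℕ → ℝ)
    (htmono : ∀ k : ℕ, 1 ≤ k → k ≤ N → t (k-1) < t k) (i j : ℕ) (hij : i ≤ j) (hj : j ≤ N) :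
    t i ≤ t j := by
  induction j, hij using Nat.le_induction with
  | base => exact le_refl _
  | succ j hij ih =>
    have := htmono (j+1) (by omega) hj
    simp only [Nat.add_sub_cancel] at this
    linarith [ih (by omega)]

lemma aux_pos (N : ℕ) (t : ℕ → ℝ) (ht0 : t 0 = 0)
    (htmono : ∀ k : ℕ, 1 ≤ k → k ≤ N → t (k-1) < t k) (j : ℕ) (h1 : 1 ≤ j) (hj : j ≤ N) :
    0 < t j := by
  have := aux_mono N t htmono 0 (j-1) (by omega) (by omega)
  have := htmono j h1 hj
  linarith

lemma aux_sum_range (g : ℕ → ℝ) (m : ℕ) :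
    ∑ k ∈ Finset.Icc 1 m, g k = ∑ k ∈ Finset.range m, g (k+1) := by
  induction m with
  | zero => simp
  | succ m ih => rw [Finset.sum_Icc_succ_top (by omega), ih, Finset.sum_range_succ]

lemma aux_swap (A : ℕ → ℕ → ℝ) (Q w : ℕ → ℝ) (m : ℕ) :
    ∑ j ∈ Finset.Icc 1 m, Q j * ∑ k ∈ Finset.Icc 1 j, A j (j-k) * w k =
      ∑ k ∈ Finset.Icc 1 m, w k * ∑ j ∈ Finset.Icc k m, Q j * A j (j-k) := by
  simp_rw [Finset.mul_sum]
  rw [Finset.sum_comm' (t' := Finset.Icc 1 m) (s' := fun k => Finset.Icc k m)]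
  · refine Finset.sum_congr rfl fun k _ => Finset.sum_congr rfl fun j _ => ?_
    ring
  · intro j k
    simp only [Finset.mem_Icc]
    omega

lemma aux_orth (N : ℕ) (A P : ℕ → ℕ → ℝ)
    (hA1pos : ∀ n : ℕ, 1 ≤ n → n ≤ N → 0 < A n 0)
    (hP0 : ∀ n : ℕ, 1 ≤ n → n ≤ N → P n 0 = 1 / A n 0)
    (hPrec : ∀ n j : ℕ, 1 ≤ j → j + 1 ≤ n → n ≤ N →
      P n (n-j) = (1 / A j 0) *
        ∑ k ∈ Finset.Icc (j+1) n, (A k (k-j-1) - A k (k-j)) * P n (n-k))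
    (n : ℕ) (hnN : n ≤ N) (k : ℕ) (hkn : k ≤ n) (hk : 1 ≤ k) :
    ∑ j ∈ Finset.Icc k n, P n (n-j) * A j (j-k) = 1 := by
  induction hkn using Nat.decreasingInduction with
  | self =>
    have := hA1pos n hk hnN
    simp only [Finset.Icc_self, Finset.sum_singleton, Nat.sub_self]
    rw [hP0 n hk hnN]; field_simp
  | of_succ k hkn ih =>
    have hA := hA1pos k hk (by omega)
    have ih := ih (by omega)
    rw [← Finset.add_sum_Ioc_eq_sum_Icc (by omega : k ≤ n), hPrec n k hk hkn hnN]
    have e : Finset.Ioc k n = Finset.Icc (k+1) n := by ext; simp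
    rw [e, Nat.sub_self, mul_comm, ← mul_assoc, mul_one_div_cancel hA.ne', one_mul,
      ← Finset.sum_add_distrib, ← ih]
    refine Finset.sum_congr rfl fun j _ => ?_
    rw [Nat.sub_sub]; ring

lemma aux_A_pos (N : ℕ) (A : ℕ → ℕ → ℝ)
    (hA1mono : ∀ n k : ℕ, 2 ≤ k → k ≤ n → n ≤ N → A n (k-1) ≤ A n (k-2) ∧ 0 < A n (k-1))
    (hA1pos : ∀ n : ℕ, 1 ≤ n → n ≤ N → 0 < A n 0)
    (n k : ℕ) (hk : k + 1 ≤ n) (hnN : n ≤ N) : 0 < A n k := by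
  rcases Nat.eq_zero_or_pos k with h | h
  · subst h; exact hA1pos n (by omega) hnN
  · have := (hA1mono n (k+1) (by omega) hk hnN).2
    simpa using this

lemma aux_P_nonneg (N : ℕ) (A P : ℕ → ℕ → ℝ)
    (hA1mono : ∀ n k : ℕ, 2 ≤ k → k ≤ n → n ≤ N → A n (k-1) ≤ A n (k-2) ∧ 0 < A n (k-1))
    (hA1pos : ∀ n : ℕ, 1 ≤ n → n ≤ N → 0 < A n 0)
    (hP0 : ∀ n : ℕ, 1 ≤ n → n ≤ N → P n 0 = 1 / A n 0)
    (hPrec : ∀ n j : ℕ, 1 ≤ j → j + 1 ≤ n → n ≤ N →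
      P n (n-j) = (1 / A j 0) *
        ∑ k ∈ Finset.Icc (j+1) n, (A k (k-j-1) - A k (k-j)) * P n (n-k))
    (n : ℕ) (hnN : n ≤ N) : ∀ i j : ℕ, n - j = i → j ≤ n → 1 ≤ j → 0 ≤ P n (n-j) := by
  intro i
  induction i using Nat.strong_induction_on with
  | _ i ih =>
    intro j hij hjn hj
    rcases Nat.lt_or_ge j n with h | h
    · rw [hPrec n j hj h hnN]
      have hA := hA1pos j hj (by omega)
      apply mul_nonneg (by positivity)
      apply Finset.sum_nonneg
      intro k hk
      rw [Finset.mem_Icc] at hk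
      apply mul_nonneg
      · have := (hA1mono k (k-j+1) (by omega) (by omega) (by omega)).1
        have e1 : k - j + 1 - 1 = k - j := by omega
        have e2 : k - j + 1 - 2 = k - j - 1 := by omega
        rw [e1, e2] at this
        linarith
      · exact ih (n - k) (by omega) k rfl hk.2 (by omega)
    · have : j = n := by omega
      subst this
      rw [Nat.sub_self, hP0 j hj hnN]
      have hA := hA1pos j hj (by omega)
      positivity

lemma aux_A2 (N : ℕ) (α πA : ℝ) (hα1 : α < 1) (hπA : 0 < πA) (t : ℕ → ℝ)
    (htmono : ∀ k : ℕ, 1 ≤ k → k ≤ N → t (k-1) < t k)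
    (A : ℕ → ℕ → ℝ)
    (hA2 : ∀ n k : ℕ, 1 ≤ k → k ≤ n → n ≤ N →
      (1 / (πA * (t k - t (k-1)))) *
        ∫ s in (t (k-1))..(t k), (t n - s) ^ (-α) / Real.Gamma (1-α) ≤ A n (n-k))
    (n k : ℕ) (hk : 1 ≤ k) (hkn : k ≤ n) (hn : n ≤ N) :
    ∫ s in (t (k-1))..(t k), (t n - s) ^ (-α) ≤
      Real.Gamma (1-α) * πA * (t k - t (k-1)) * A n (n-k) := by
  have h := hA2 n k hk hkn hn
  have hG := Real.Gamma_pos_of_pos (show 0 < 1 - α by linarith)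
  have ht : 0 < t k - t (k-1) := by linarith [htmono k hk (by omega)]
  rw [intervalIntegral.integral_div, one_div_mul_eq_div, div_div, div_le_iff₀ (by positivity)] at h
  linarith

lemma aux_eta (N : ℕ) (α πA : ℝ) (hα0 : 0 < α) (hα1 : α < 1) (hπA : 0 < πA) (t : ℕ → ℝ)
    (ht0 : t 0 = 0)
    (htmono : ∀ k : ℕ, 1 ≤ k → k ≤ N → t (k-1) < t k)
    (A : ℕ → ℕ → ℝ)
    (hA2 : ∀ n k : ℕ, 1 ≤ k → k ≤ n → n ≤ N →
      (1 / (πA * (t k - t (k-1)))) *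
        ∫ s in (t (k-1))..(t k), (t n - s) ^ (-α) / Real.Gamma (1-α) ≤ A n (n-k))
    (n : ℕ) (hn1 : 1 ≤ n) (hn : n ≤ N) (Q : ℕ → ℝ) (hQ : ∀ j, 1 ≤ j → j ≤ n → 0 ≤ Q j)
    (hQA : ∑ j ∈ Finset.Icc 1 n, Q j * A j (j-1) = 1) :
    ∑ j ∈ Finset.Icc 1 n, Q j * t j ^ (-α) ≤ πA * Real.Gamma (1-α) := by
  rw [show πA * Real.Gamma (1-α) = ∑ j ∈ Finset.Icc 1 n,
    πA * Real.Gamma (1-α) * (Q j * A j (j-1)) by rw [← Finset.mul_sum, hQA, mul_one]]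
  apply Finset.sum_le_sum
  intro j hj
  rw [Finset.mem_Icc] at hj
  have h := aux_A2 N α πA hα1 hπA t htmono A hA2 j 1 (le_refl _) hj.1 (by omega)
  simp only [Nat.sub_self, ht0, sub_zero] at h
  have ht1 := aux_pos N t ht0 htmono 1 (le_refl _) (by omega)
  have htj := aux_mono N t htmono 1 j (by omega) (by omega)
  have h2 : t 1 * t j ^ (-α) ≤ ∫ s in (0:ℝ)..(t 1), (t j - s) ^ (-α) := by
    have : t 1 * t j ^ (-α) = ∫ s in (0:ℝ)..(t 1), t j ^ (-α) := by simp
    rw [this]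
    apply intervalIntegral.integral_mono_on_of_le_Ioo ht1.le intervalIntegrable_const
      (aux_f_int _ _ _ _ hα1)
    intro x hx
    exact Real.rpow_le_rpow_of_nonpos (by linarith [hx.2]) (by linarith [hx.1]) (by linarith)
  have h3 : t j ^ (-α) ≤ πA * Real.Gamma (1-α) * A j (j-1) := by
    have := h2.trans h
    apply le_of_mul_le_mul_left _ ht1
    linarith
  have := mul_le_mul_of_nonneg_left h3 (hQ j hj.1 hj.2)
  linarith

lemma aux_cell (N : ℕ) (α πA ρ β : ℝ) (hα0 : 0 < α) (hα1 : α < 1) (hβ : 0 < β)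
    (hπA : 0 < πA) (hρ : 0 < ρ) (t : ℕ → ℝ)
    (ht0 : t 0 = 0)
    (htmono : ∀ k : ℕ, 1 ≤ k → k ≤ N → t (k-1) < t k)
    (A : ℕ → ℕ → ℝ)
    (hA1mono : ∀ n k : ℕ, 2 ≤ k → k ≤ n → n ≤ N → A n (k-1) ≤ A n (k-2) ∧ 0 < A n (k-1))
    (hA1pos : ∀ n : ℕ, 1 ≤ n → n ≤ N → 0 < A n 0)
    (hA2 : ∀ n k : ℕ, 1 ≤ k → k ≤ n → n ≤ N →
      (1 / (πA * (t k - t (k-1)))) *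
        ∫ s in (t (k-1))..(t k), (t n - s) ^ (-α) / Real.Gamma (1-α) ≤ A n (n-k))
    (hA3 : ∀ k : ℕ, 1 ≤ k → k ≤ N - 1 → (t k - t (k-1)) / (t (k+1) - t k) ≤ ρ)
    (m : ℕ) (hm : m + 1 ≤ N) :
    ∃ C : ℕ → ℝ, (∀ k, 1 ≤ k → k ≤ m → 0 ≤ C k) ∧
      (∑ k ∈ Finset.Icc 1 m, C k ≤ max 1 ρ * t (m+1) ^ β / β) ∧
      ∀ j k, 1 ≤ k → k ≤ j → j ≤ m →
        ∫ s in (t (k-1))..(t k), (t j - s) ^ (-α) * s ^ (β - 1) ≤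
          Real.Gamma (1-α) * πA * (A j (j-k) * C k) := by
  have hG := Real.Gamma_pos_of_pos (show 0 < 1 - α by linarith)
  have hnn : ∀ j, j ≤ N → 0 ≤ t j := fun j hj => by
    have := aux_mono N t htmono 0 j (by omega) hj
    linarith
  have hmax1 : 1 ≤ max 1 ρ := le_max_left _ _
  have hmaxρ : ρ ≤ max 1 ρ := le_max_right _ _
  rcases le_total β 1 with hb | hb
  · refine ⟨fun k => (t k ^ β - t (k-1) ^ β) / β, ?_, ?_, ?_⟩
    · intro k h1 h2
      have := Real.rpow_le_rpow (hnn (k-1) (by omega)) (htmono k h1 (by omega)).le hβ.le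
      apply div_nonneg _ hβ.le
      linarith
    · rw [← Finset.sum_div, aux_sum_range]
      simp only [Nat.add_sub_cancel]
      rw [Finset.sum_range_sub (fun k => t k ^ β), ht0, Real.zero_rpow hβ.ne', sub_zero]
      have h1 := Real.rpow_le_rpow (hnn m (by omega))
        (aux_mono N t htmono m (m+1) (by omega) hm) hβ.le
      have h2 : 0 ≤ t (m+1) ^ β := Real.rpow_nonneg (hnn _ hm) _
      gcongr
      nlinarith
    · intro j k hk hkj hj
      have hlt := htmono k hk (by omega)
      have h1 := aux_cell1 α β (t j) (t (k-1)) (t k) hα0 hα1 hβ hb (hnn _ (by omega))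
        hlt (aux_mono N t htmono k j hkj (by omega))
      have h2 := aux_A2 N α πA hα1 hπA t htmono A hA2 j k hk hkj (by omega)
      refine h1.trans ?_
      have h3 := Real.rpow_le_rpow (hnn (k-1) (by omega)) hlt.le hβ.le
      have h4 : 0 ≤ (t k ^ β - t (k-1) ^ β) / β / (t k - t (k-1)) := by
        apply div_nonneg (div_nonneg _ hβ.le) <;> linarith
      refine (mul_le_mul_of_nonneg_right h2 h4).trans (le_of_eq ?_)
      have : t k - t (k-1) ≠ 0 := by linarith
      field_simp
  · have hdiff : ∀ k, 1 ≤ k → k ≤ m →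
        t k ^ (β - 1) * (t (k+1) - t k) ≤ (t (k+1) ^ β - t k ^ β) / β := by
      intro k h1 h2
      have hlt := htmono (k+1) (by omega) (by omega)
      simp only [Nat.add_sub_cancel] at hlt
      obtain ⟨c, hc, h⟩ := aux_mvt β (t k) (t (k+1)) hβ (hnn _ (by omega)) hlt
      rw [eq_div_iff (by linarith)] at h
      rw [← h]
      have := Real.rpow_le_rpow (hnn k (by omega)) hc.1.le (show 0 ≤ β - 1 by linarith)
      have : 0 ≤ t (k+1) - t k := by linarith
      gcongr
    refine ⟨fun k => ρ * ((t (k+1) ^ β - t k ^ β) / β), ?_, ?_, ?_⟩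
    · intro k h1 h2
      have hlt := htmono (k+1) (by omega) (by omega)
      simp only [Nat.add_sub_cancel] at hlt
      have := Real.rpow_le_rpow (hnn (k) (by omega)) hlt.le hβ.le
      apply mul_nonneg hρ.le
      apply div_nonneg _ hβ.le
      linarith
    · rw [← Finset.mul_sum, ← Finset.sum_div, aux_sum_range]
      rw [Finset.sum_range_sub (fun k => t (k+1) ^ β)]
      have h2 : 0 ≤ t (m+1) ^ β := Real.rpow_nonneg (hnn _ hm) _
      have h3 : 0 ≤ t (0+1) ^ β := Real.rpow_nonneg (hnn _ (by omega)) _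
      rw [← mul_div_assoc]
      apply div_le_div_of_nonneg_right _ hβ.le
      nlinarith
    · intro j k hk hkj hj
      have hlt := htmono k hk (by omega)
      have hlt' := htmono (k+1) (by omega) (by omega)
      simp only [Nat.add_sub_cancel] at hlt'
      have h1 := aux_cell2 α β (t j) (t (k-1)) (t k) hα1 hb (hnn _ (by omega))
        hlt (aux_mono N t htmono k j hkj (by omega))
      have h2 := aux_A2 N α πA hα1 hπA t htmono A hA2 j k hk hkj (by omega)
      have h3 : 0 ≤ t k ^ (β - 1) := Real.rpow_nonneg (hnn _ (by omega)) _
      refine h1.trans ((mul_le_mul_of_nonneg_right h2 h3).trans ?_)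
      have h4 := hA3 k hk (by omega)
      rw [div_le_iff₀ (by linarith)] at h4
      have hA := aux_A_pos N A hA1mono hA1pos j (j-k) (by omega) (by omega)
      have h5 : (t k - t (k-1)) * t k ^ (β - 1) ≤ ρ * ((t (k+1) ^ β - t k ^ β) / β) := by
        calc _ ≤ ρ * (t (k+1) - t k) * t k ^ (β - 1) := by gcongr
          _ = ρ * (t k ^ (β - 1) * (t (k+1) - t k)) := by ring
          _ ≤ _ := mul_le_mul_of_nonneg_left (hdiff k hk (by omega)) hρ.le
      calc _ = Real.Gamma (1-α) * πA * A j (j-k) * ((t k - t (k-1)) * t k ^ (β - 1)) := by ring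
        _ ≤ Real.Gamma (1-α) * πA * A j (j-k) * (ρ * ((t (k+1) ^ β - t k ^ β) / β)) := by gcongr
        _ = _ := by ring

lemma aux_omega (N : ℕ) (α πA ρ β : ℝ) (hα0 : 0 < α) (hα1 : α < 1) (hβ : 0 < β)
    (hπA : 0 < πA) (hρ : 0 < ρ) (t : ℕ → ℝ)
    (ht0 : t 0 = 0)
    (htmono : ∀ k : ℕ, 1 ≤ k → k ≤ N → t (k-1) < t k)
    (A : ℕ → ℕ → ℝ)
    (hA1mono : ∀ n k : ℕ, 2 ≤ k → k ≤ n → n ≤ N → A n (k-1) ≤ A n (k-2) ∧ 0 < A n (k-1))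
    (hA1pos : ∀ n : ℕ, 1 ≤ n → n ≤ N → 0 < A n 0)
    (hA2 : ∀ n k : ℕ, 1 ≤ k → k ≤ n → n ≤ N →
      (1 / (πA * (t k - t (k-1)))) *
        ∫ s in (t (k-1))..(t k), (t n - s) ^ (-α) / Real.Gamma (1-α) ≤ A n (n-k))
    (hA3 : ∀ k : ℕ, 1 ≤ k → k ≤ N - 1 → (t k - t (k-1)) / (t (k+1) - t k) ≤ ρ)
    (m : ℕ) (hm : m + 1 ≤ N)
    (Q : ℕ → ℝ) (hQ : ∀ j, 1 ≤ j → j ≤ m + 1 → 0 ≤ Q j)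
    (hQA : ∀ k, 1 ≤ k → k ≤ m + 1 → ∑ j ∈ Finset.Icc k (m+1), Q j * A j (j-k) = 1) :
    ∑ j ∈ Finset.Icc 1 m, Q j * (t j ^ (β - α) / Real.Gamma (1 + β - α)) ≤
      πA * max 1 ρ * t (m+1) ^ β / Real.Gamma (1 + β) := by
  have hG := Real.Gamma_pos_of_pos (show 0 < 1 - α by linarith)
  have hGβ := Real.Gamma_pos_of_pos hβ
  have hGβα := Real.Gamma_pos_of_pos (show 0 < 1 + β - α by linarith)
  obtain ⟨C, hC0, hCs, hC⟩ := aux_cell N α πA ρ β hα0 hα1 hβ hπA hρ t ht0 htmono A hA1mono hA1pos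
    hA2 hA3 m hm
  have hj : ∀ j, 1 ≤ j → j ≤ m → t j ^ (β - α) / Real.Gamma (1 + β - α) ≤
      πA / Real.Gamma β * ∑ k ∈ Finset.Icc 1 j, A j (j-k) * C k := by
    intro j hj1 hjm
    have htj := aux_pos N t ht0 htmono j hj1 (by omega)
    have hb := aux_beta α β (t j) hα1 hβ htj
    have hbi := aux_beta_int α β (t j) hα1 hβ htj
    have hsum : ∑ k ∈ Finset.Icc 1 j, ∫ s in (t (k-1))..(t k), (t j - s) ^ (-α) * s ^ (β - 1)
        = ∫ x in (0:ℝ)..(t j), (t j - x) ^ (-α) * x ^ (β - 1) := by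
      rw [aux_sum_range]
      simp only [Nat.add_sub_cancel]
      rw [intervalIntegral.sum_integral_adjacent_intervals, ht0]
      intro k hk
      apply hbi.mono_set
      have h1 := aux_mono N t htmono 0 k (by omega) (by omega)
      have h2 := aux_mono N t htmono k (k+1) (by omega) (by omega)
      have h3 := aux_mono N t htmono (k+1) j (by omega) (by omega)
      rw [uIcc_of_le h2, uIcc_of_le htj.le]
      exact Icc_subset_Icc (by linarith) h3
    have hle : ∑ k ∈ Finset.Icc 1 j, ∫ s in (t (k-1))..(t k), (t j - s) ^ (-α) * s ^ (β - 1)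
        ≤ ∑ k ∈ Finset.Icc 1 j, Real.Gamma (1-α) * πA * (A j (j-k) * C k) := by
      apply Finset.sum_le_sum
      intro k hk
      rw [Finset.mem_Icc] at hk
      exact hC j k hk.1 hk.2 hjm
    rw [hsum, hb, ← Finset.mul_sum] at hle
    apply le_of_mul_le_mul_left _ (mul_pos hG hGβ)
    calc _ = _ := by ring
      _ ≤ _ := hle
      _ = _ := by field_simp
  calc _ ≤ ∑ j ∈ Finset.Icc 1 m, Q j *
        (πA / Real.Gamma β * ∑ k ∈ Finset.Icc 1 j, A j (j-k) * C k) := by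
        apply Finset.sum_le_sum
        intro j hjm
        rw [Finset.mem_Icc] at hjm
        exact mul_le_mul_of_nonneg_left (hj j hjm.1 hjm.2) (hQ j hjm.1 (by omega))
    _ = πA / Real.Gamma β * ∑ k ∈ Finset.Icc 1 m, C k * ∑ j ∈ Finset.Icc k m, Q j * A j (j-k) := by
        rw [← aux_swap, Finset.mul_sum]
        refine Finset.sum_congr rfl fun j _ => ?_
        ring
    _ ≤ πA / Real.Gamma β * ∑ k ∈ Finset.Icc 1 m, C k * 1 := by
        apply mul_le_mul_of_nonneg_left _ (by positivity)
        apply Finset.sum_le_sum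
        intro k hk
        rw [Finset.mem_Icc] at hk
        apply mul_le_mul_of_nonneg_left _ (hC0 k hk.1 hk.2)
        rw [← hQA k hk.1 (by omega), Finset.sum_Icc_succ_top (by omega)]
        have := mul_nonneg (hQ (m+1) (by omega) (le_refl _))
          (aux_A_pos N A hA1mono hA1pos (m+1) (m+1-k) (by omega) hm).le
        linarith
    _ ≤ πA / Real.Gamma β * (max 1 ρ * t (m+1) ^ β / β) := by
        simp only [mul_one]
        exact mul_le_mul_of_nonneg_left hCs (by positivity)
    _ = _ := by
        rw [add_comm 1 β, Real.Gamma_add_one hβ.ne']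
        field_simp

lemma aux_ml (N : ℕ) (α πA ρ μ : ℝ) (hα0 : 0 < α) (hα1 : α < 1) (hμ : 0 < μ)
    (hπA : 0 < πA) (hρ : 0 < ρ) (t : ℕ → ℝ)
    (ht0 : t 0 = 0)
    (htmono : ∀ k : ℕ, 1 ≤ k → k ≤ N → t (k-1) < t k)
    (A : ℕ → ℕ → ℝ)
    (hA1mono : ∀ n k : ℕ, 2 ≤ k → k ≤ n → n ≤ N → A n (k-1) ≤ A n (k-2) ∧ 0 < A n (k-1))
    (hA1pos : ∀ n : ℕ, 1 ≤ n → n ≤ N → 0 < A n 0)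
    (hA2 : ∀ n k : ℕ, 1 ≤ k → k ≤ n → n ≤ N →
      (1 / (πA * (t k - t (k-1)))) *
        ∫ s in (t (k-1))..(t k), (t n - s) ^ (-α) / Real.Gamma (1-α) ≤ A n (n-k))
    (hA3 : ∀ k : ℕ, 1 ≤ k → k ≤ N - 1 → (t k - t (k-1)) / (t (k+1) - t k) ≤ ρ)
    (m : ℕ) (hm : m + 1 ≤ N)
    (Q : ℕ → ℝ) (hQ : ∀ j, 1 ≤ j → j ≤ m + 1 → 0 ≤ Q j)
    (hQA : ∀ k, 1 ≤ k → k ≤ m + 1 → ∑ j ∈ Finset.Icc k (m+1), Q j * A j (j-k) = 1) :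
    μ * ∑ j ∈ Finset.Icc 1 m, Q j *
        (∑' i : ℕ, (μ * t j ^ α) ^ i / Real.Gamma (1 + (i:ℝ) * α)) ≤
      πA * max 1 ρ *
        ((∑' i : ℕ, (μ * t (m+1) ^ α) ^ i / Real.Gamma (1 + (i:ℝ) * α)) - 1) := by
  have hnn : ∀ j, j ≤ N → 0 ≤ t j := fun j hj => by
    have := aux_mono N t htmono 0 j (by omega) hj
    linarith
  have hs : ∀ j, j ≤ N → Summable
      (fun i : ℕ => (μ * t j ^ α) ^ i / Real.Gamma (1 + (i:ℝ) * α)) := fun j hj =>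
    aux_ml_summable α _ hα0 (mul_nonneg hμ.le (Real.rpow_nonneg (hnn j hj) _))
  have hs' := hs (m+1) hm
  rw [hs'.tsum_eq_zero_add]
  simp only [pow_zero, Nat.cast_zero, zero_mul, add_zero, Real.Gamma_one, div_one,
    add_sub_cancel_left]
  have e : ∑ j ∈ Finset.Icc 1 m, Q j *
        (∑' i : ℕ, (μ * t j ^ α) ^ i / Real.Gamma (1 + (i:ℝ) * α)) =
      ∑' i : ℕ, ∑ j ∈ Finset.Icc 1 m,
        Q j * ((μ * t j ^ α) ^ i / Real.Gamma (1 + (i:ℝ) * α)) := by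
    rw [Summable.tsum_finsetSum]
    · refine Finset.sum_congr rfl fun j _ => ?_
      rw [tsum_mul_left]
    · intro j hj
      rw [Finset.mem_Icc] at hj
      exact (hs j (by omega)).mul_left _
  rw [e, ← tsum_mul_left, ← tsum_mul_left]
  apply Summable.tsum_le_tsum
  · intro i
    have h := aux_omega N α πA ρ (((i + 1 : ℕ) : ℝ) * α) hα0 hα1 (by positivity) hπA hρ t ht0
      htmono A hA1mono hA1pos hA2 hA3 m hm Q hQ hQA
    have hμi : 0 ≤ μ ^ (i+1) := by positivity
    have h' := mul_le_mul_of_nonneg_left h hμi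
    refine le_trans (le_of_eq ?_) (h'.trans (le_of_eq ?_))
    · rw [Finset.mul_sum, Finset.mul_sum]
      refine Finset.sum_congr rfl fun j hj => ?_
      rw [Finset.mem_Icc] at hj
      have e1 : ((i + 1 : ℕ) : ℝ) * α - α = α * (i:ℝ) := by push_cast; ring
      have e2 : 1 + ((i + 1 : ℕ) : ℝ) * α - α = 1 + (i:ℝ) * α := by push_cast; ring
      rw [e1, e2, Real.rpow_mul (hnn j (by omega)), Real.rpow_natCast, mul_pow]
      ring
    · rw [mul_comm ((i + 1 : ℕ) : ℝ) α, Real.rpow_mul (hnn (m+1) hm), Real.rpow_natCast, mul_pow]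
      ring
  · apply Summable.mul_left
    apply summable_sum
    intro j hj
    rw [Finset.mem_Icc] at hj
    exact (hs j (by omega)).mul_left _
  · apply Summable.mul_left
    exact (summable_nat_add_iff 1).mpr hs'

lemma aux_A0 (N : ℕ) (α πA Λ τ : ℝ) (hα0 : 0 < α) (hα1 : α < 1) (hπA : 0 < πA) (hΛ : 0 < Λ)
    (t : ℕ → ℝ)
    (htmono : ∀ k : ℕ, 1 ≤ k → k ≤ N → t (k-1) < t k)
    (A : ℕ → ℕ → ℝ)
    (hA2 : ∀ n k : ℕ, 1 ≤ k → k ≤ n → n ≤ N →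
      (1 / (πA * (t k - t (k-1)))) *
        ∫ s in (t (k-1))..(t k), (t n - s) ^ (-α) / Real.Gamma (1-α) ≤ A n (n-k))
    (hτ : ∀ k : ℕ, 1 ≤ k → k ≤ N → t k - t (k-1) ≤ τ)
    (hτbound : τ ≤ (2 * πA * Real.Gamma (2-α) * Λ) ^ (-(1:ℝ)/α))
    (n : ℕ) (hn1 : 1 ≤ n) (hn : n ≤ N) : 2 * Λ ≤ A n 0 := by
  have hG := Real.Gamma_pos_of_pos (show 0 < 1 - α by linarith)
  have hG2 : Real.Gamma (2 - α) = (1 - α) * Real.Gamma (1 - α) := by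
    rw [← Real.Gamma_add_one (by linarith)]; congr 1; ring
  have hG2p := Real.Gamma_pos_of_pos (show 0 < 2 - α by linarith)
  have h := aux_A2 N α πA hα1 hπA t htmono A hA2 n n hn1 (le_refl _) hn
  set d := t n - t (n-1) with hd
  have hd0 : 0 < d := by linarith [htmono n hn1 hn]
  have hI : ∫ s in (t (n-1))..(t n), (t n - s) ^ (-α) = d ^ (1 - α) / (1 - α) := by
    rw [intervalIntegral.integral_comp_sub_left (fun x => x ^ (-α)) (t n), sub_self, ← hd,
      integral_rpow (Or.inl (by linarith)), Real.zero_rpow (by linarith), sub_zero]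
    congr 1
    · congr 1; ring
    · ring
  rw [hI, Nat.sub_self, div_le_iff₀ (by linarith)] at h
  have e : d ^ (1 - α) = d * (d ^ α)⁻¹ := by
    rw [Real.rpow_sub hd0, Real.rpow_one]; rfl
  have hK : 0 < 2 * πA * Real.Gamma (2-α) * Λ := by positivity
  have hdα : d ^ α ≤ (2 * πA * Real.Gamma (2-α) * Λ)⁻¹ := by
    have h1 : d ≤ (2 * πA * Real.Gamma (2-α) * Λ) ^ (-(1:ℝ)/α) := (hτ n hn1 hn).trans hτbound
    have h2 := Real.rpow_le_rpow hd0.le h1 hα0.le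
    rwa [← Real.rpow_mul hK.le, div_mul_cancel₀ _ hα0.ne', Real.rpow_neg_one] at h2
  have hdp : 0 < d ^ α := Real.rpow_pos_of_pos hd0 _
  have h3 : 2 * πA * Real.Gamma (2-α) * Λ ≤ (d ^ α)⁻¹ := by
    rwa [le_inv_comm₀ hK hdp]
  rw [e] at h
  have h4 : (d ^ α)⁻¹ ≤ πA * Real.Gamma (2 - α) * A n 0 := by
    apply le_of_mul_le_mul_left _ hd0
    rw [hG2]; linarith
  have h5 := h3.trans h4
  apply le_of_mul_le_mul_left _ (mul_pos hπA hG2p)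
  linarith

lemma aux_lam (N : ℕ) (lam : ℕ → ℝ) (Λ : ℝ)
    (hlam : ∀ l : ℕ, l ≤ N - 1 → 0 ≤ lam l)
    (hΛ : ∑ l ∈ Finset.range N, lam l ≤ Λ) (j : ℕ) (hj : j ≤ N) :
    ∑ k ∈ Finset.Icc 1 j, lam (j-k) ≤ Λ := by
  rw [aux_sum_range]
  have : ∑ k ∈ Finset.range j, lam (j - (k+1)) = ∑ k ∈ Finset.range j, lam k := by
    rw [← Finset.sum_range_reflect lam]
    refine Finset.sum_congr rfl fun k _ => ?_
    congr 1; omega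
  rw [this]
  refine le_trans (Finset.sum_le_sum_of_subset_of_nonneg (Finset.range_mono hj) ?_) hΛ
  intro i hi _
  rw [Finset.mem_range] at hi
  exact hlam i (by omega)

set_option maxHeartbeats 1600000 in
lemma aux_main (N : ℕ) (α ν πA ρ Λ τ : ℝ)
    (hα0 : 0 < α) (hα1 : α < 1) (hν0 : 0 ≤ ν) (hν1 : ν < 1/2) (hπA : 0 < πA) (hρ : 0 < ρ)
    (t : ℕ → ℝ) (ht0 : t 0 = 0)
    (htmono : ∀ k : ℕ, 1 ≤ k → k ≤ N → t (k-1) < t k)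
    (A P : ℕ → ℕ → ℝ)
    (hA1mono : ∀ n k : ℕ, 2 ≤ k → k ≤ n → n ≤ N → A n (k-1) ≤ A n (k-2) ∧ 0 < A n (k-1))
    (hA1pos : ∀ n : ℕ, 1 ≤ n → n ≤ N → 0 < A n 0)
    (hA2 : ∀ n k : ℕ, 1 ≤ k → k ≤ n → n ≤ N →
      (1 / (πA * (t k - t (k-1)))) *
        ∫ s in (t (k-1))..(t k), (t n - s) ^ (-α) / Real.Gamma (1-α) ≤ A n (n-k))
    (hA3 : ∀ k : ℕ, 1 ≤ k → k ≤ N - 1 → (t k - t (k-1)) / (t (k+1) - t k) ≤ ρ)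
    (hP0 : ∀ n : ℕ, 1 ≤ n → n ≤ N → P n 0 = 1 / A n 0)
    (hPrec : ∀ n j : ℕ, 1 ≤ j → j + 1 ≤ n → n ≤ N →
      P n (n-j) = (1 / A j 0) *
        ∑ k ∈ Finset.Icc (j+1) n, (A k (k-j-1) - A k (k-j)) * P n (n-k))
    (ξ η lam : ℕ → ℝ)
    (hξ : ∀ n : ℕ, 1 ≤ n → n ≤ N → 0 ≤ ξ n)
    (hη : ∀ n : ℕ, 1 ≤ n → n ≤ N → 0 ≤ η n)
    (hlam : ∀ l : ℕ, l ≤ N - 1 → 0 ≤ lam l)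
    (hΛ : ∑ l ∈ Finset.range N, lam l ≤ Λ) (hΛ0 : 0 < Λ)
    (hτ : ∀ k : ℕ, 1 ≤ k → k ≤ N → t k - t (k-1) ≤ τ)
    (hτbound : τ ≤ (2 * πA * Real.Gamma (2-α) * Λ) ^ (-(1:ℝ)/α))
    (v : ℕ → ℝ) (hv : ∀ k : ℕ, k ≤ N → 0 ≤ v k)
    (hineq : ∀ n : ℕ, 1 ≤ n → n ≤ N →
      ∑ k ∈ Finset.Icc 1 n, A n (n-k) * ((v k)^2 - (v (k-1))^2) ≤
        ∑ k ∈ Finset.Icc 1 n, lam (n-k) * (ν * v (k-1) + (1-ν) * v k)^2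
          + (ν * v (n-1) + (1-ν) * v n) * ξ n + (η n)^2)
    (n : ℕ) (hnN : n ≤ N) (G M : ℝ) (hG0 : 0 ≤ G) (hM0 : 0 ≤ M)
    (hG : ∀ k, 1 ≤ k → k ≤ n → ∑ j ∈ Finset.Icc 1 k, P k (k-j) * ξ j ≤ G)
    (hM : ∀ k, 1 ≤ k → k ≤ n → t k ^ (α/2) * η k ≤ M) (i : ℕ) (hi : i ≤ n) :
    v i ≤ 2 * (∑' l : ℕ, (2 * max 1 ρ * πA * Λ * t i ^ α) ^ l / Real.Gamma (1 + (l:ℝ) * α)) *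
        (v 0 + G + Real.sqrt (πA * Real.Gamma (1-α)) * M) := by
  have hGa := Real.Gamma_pos_of_pos (show 0 < 1 - α by linarith)
  have hnn : ∀ j, j ≤ N → 0 ≤ t j := fun j hj => by
    have := aux_mono N t htmono 0 j (by omega) hj
    linarith
  set μ := 2 * max 1 ρ * πA * Λ with hμdef
  have hmx : 0 < max 1 ρ := lt_max_of_lt_left one_pos
  have hμ : 0 < μ := by positivity
  set S := Real.sqrt (πA * Real.Gamma (1-α)) * M with hS
  have hS0 : 0 ≤ S := by positivity
  have hS2 : S ^ 2 = πA * Real.Gamma (1-α) * M ^ 2 := by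
    rw [hS, mul_pow, Real.sq_sqrt (by positivity)]
  set Ψ := v 0 + G + S with hΨ
  have hv0 := hv 0 (by omega)
  have hΨ0 : 0 ≤ Ψ := by positivity
  set E : ℕ → ℝ := fun i => ∑' l : ℕ, (μ * t i ^ α) ^ l / Real.Gamma (1 + (l:ℝ) * α) with hE
  have hsm : ∀ j, j ≤ N → Summable
      (fun i : ℕ => (μ * t j ^ α) ^ i / Real.Gamma (1 + (i:ℝ) * α)) := fun j hj =>
    aux_ml_summable α _ hα0 (mul_nonneg hμ.le (Real.rpow_nonneg (hnn j hj) _))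
  have hGl : ∀ l : ℕ, 0 < Real.Gamma (1 + (l:ℝ) * α) := fun l =>
    Real.Gamma_pos_of_pos (by positivity)
  have hE1 : ∀ j, j ≤ N → 1 ≤ E j := by
    intro j hj
    have h := (hsm j hj).le_tsum 0 (fun l _ => by
      have := hGl l
      have := Real.rpow_nonneg (hnn j hj) α
      positivity)
    simpa using h
  have hEm : ∀ j k, j ≤ k → k ≤ N → E j ≤ E k := by
    intro j k hjk hk
    apply Summable.tsum_le_tsum _ (hsm j (by omega)) (hsm k hk)
    intro l
    have h1 := Real.rpow_le_rpow (hnn j (by omega)) (aux_mono N t htmono j k hjk hk) hα0.le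
    have := hGl l
    have := Real.rpow_nonneg (hnn j (by omega)) α
    gcongr
  change v i ≤ 2 * E i * Ψ
  induction i using Nat.strong_induction_on with
  | _ i ih =>
  rcases i with _ | m
  · have := hE1 0 (by omega)
    nlinarith
  have hmN : m + 1 ≤ N := by omega
  have hEE := hE1 (m+1) hmN
  by_cases hex : ∃ k, k ≤ m ∧ v (m+1) ≤ v k
  · obtain ⟨k, hk, hvk⟩ := hex
    have h1 := ih k (by omega) (by omega)
    have h2 := hEm k (m+1) (by omega) hmN
    have h3 := mul_le_mul_of_nonneg_right h2 hΨ0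
    linarith
  push Not at hex
  set V := v (m+1) with hV
  by_cases hVS : V ≤ S
  · have : S ≤ Ψ := by linarith
    nlinarith
  push Not at hVS
  have hVpos : 0 < V := by linarith
  set Q : ℕ → ℝ := fun j => P (m+1) (m+1-j) with hQdef
  have hQ : ∀ j, 1 ≤ j → j ≤ m + 1 → 0 ≤ Q j := fun j h1 h2 =>
    aux_P_nonneg N A P hA1mono hA1pos hP0 hPrec (m+1) hmN _ j rfl h2 h1
  have hQA : ∀ k, 1 ≤ k → k ≤ m + 1 → ∑ j ∈ Finset.Icc k (m+1), Q j * A j (j-k) = 1 :=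
    fun k h1 h2 => aux_orth N A P hA1pos hP0 hPrec (m+1) hmN k h2 h1
  have hml := aux_ml N α πA ρ μ hα0 hα1 hμ hπA hρ t ht0 htmono A hA1mono hA1pos hA2 hA3 m hmN
    Q hQ hQA
  change μ * ∑ j ∈ Finset.Icc 1 m, Q j * E j ≤ πA * max 1 ρ * (E (m+1) - 1) at hml
  have hml2 : 2 * Λ * ∑ j ∈ Finset.Icc 1 m, Q j * E j ≤ E (m+1) - 1 := by
    apply le_of_mul_le_mul_left _ (mul_pos hπA hmx)
    rw [hμdef] at hml
    linarith
  have heta := aux_eta N α πA hα0 hα1 hπA t ht0 htmono A hA2 (m+1) (by omega) hmN Q hQ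
    (hQA 1 (le_refl _) (by omega))
  have hvV : ∀ k, k ≤ m + 1 → v k ≤ V := by
    intro k hk
    rcases Nat.lt_or_ge k (m+1) with h | h
    · exact (hex k (by omega)).le
    · have : k = m + 1 := by omega
      rw [this]
  set u : ℕ → ℝ := fun k => ν * v (k-1) + (1-ν) * v k with hu
  have hu0 : ∀ k, k ≤ m + 1 → 0 ≤ u k := by
    intro k hk
    have h1 := hv k (by omega)
    have h2 := hv (k-1) (by omega)
    have h3 : 0 ≤ 1 - ν := by linarith
    simp only [hu]
    positivity
  have hub : ∀ k B, v k ≤ B → v (k-1) ≤ B → u k ≤ B := by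
    intro k B h1 h2
    simp only [hu]
    nlinarith
  have huV : ∀ k, k ≤ m + 1 → u k ≤ V := fun k hk =>
    hub k V (hvV k hk) (hvV (k-1) (by omega))
  have huF : ∀ k j, k ≤ j → j ≤ m → u k ≤ 2 * E j * Ψ := by
    intro k j hk hj
    have : ∀ l, l ≤ j → v l ≤ 2 * E j * Ψ := by
      intro l hl
      have h1 := ih l (by omega) (by omega)
      have h2 := mul_le_mul_of_nonneg_right (hEm l j hl (by omega)) hΨ0
      linarith
    exact hub k _ (this k hk) (this (k-1) (by omega))
  have hlamB : ∀ j B, j ≤ m + 1 → (∀ k, k ≤ j → u k ≤ B) →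
      ∑ k ∈ Finset.Icc 1 j, lam (j-k) * (u k)^2 ≤ Λ * (V * B) := by
    intro j B hj hB
    have hB0 : 0 ≤ B := (hu0 0 (by omega)).trans (hB 0 (by omega))
    calc _ ≤ ∑ k ∈ Finset.Icc 1 j, lam (j-k) * (V * B) := by
          apply Finset.sum_le_sum
          intro k hk
          rw [Finset.mem_Icc] at hk
          apply mul_le_mul_of_nonneg_left _ (hlam _ (by omega))
          rw [sq]
          exact mul_le_mul (huV k (by omega)) (hB k hk.2) (hu0 k (by omega)) hVpos.le
      _ = (∑ k ∈ Finset.Icc 1 j, lam (j-k)) * (V * B) := by rw [Finset.sum_mul]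
      _ ≤ _ := mul_le_mul_of_nonneg_right (aux_lam N lam Λ hlam hΛ j (by omega)) (by positivity)
  have htel : ∑ j ∈ Finset.Icc 1 (m+1), Q j *
      ∑ k ∈ Finset.Icc 1 j, A j (j-k) * ((v k)^2 - (v (k-1))^2) = V ^ 2 - v 0 ^ 2 := by
    rw [aux_swap A Q (fun k => (v k)^2 - (v (k-1))^2)]
    have : ∑ k ∈ Finset.Icc 1 (m+1), ((v k)^2 - (v (k-1))^2) *
        ∑ j ∈ Finset.Icc k (m+1), Q j * A j (j-k) =
        ∑ k ∈ Finset.Icc 1 (m+1), ((v k)^2 - (v (k-1))^2) := by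
      refine Finset.sum_congr rfl fun k hk => ?_
      rw [Finset.mem_Icc] at hk
      rw [hQA k hk.1 hk.2, mul_one]
    rw [this, aux_sum_range]
    simp only [Nat.add_sub_cancel]
    rw [Finset.sum_range_sub (fun k => v k ^ 2)]
  have hsum : V ^ 2 - v 0 ^ 2 ≤ ∑ j ∈ Finset.Icc 1 (m+1), Q j *
      (∑ k ∈ Finset.Icc 1 j, lam (j-k) * (u k)^2 + u j * ξ j + (η j)^2) := by
    rw [← htel]
    apply Finset.sum_le_sum
    intro j hj
    rw [Finset.mem_Icc] at hj
    exact mul_le_mul_of_nonneg_left (hineq j hj.1 (by omega)) (hQ j hj.1 hj.2)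
  simp only [mul_add, Finset.sum_add_distrib] at hsum
  have hT2 : ∑ j ∈ Finset.Icc 1 (m+1), Q j * (u j * ξ j) ≤ V * G := by
    calc _ ≤ ∑ j ∈ Finset.Icc 1 (m+1), V * (Q j * ξ j) := by
          apply Finset.sum_le_sum
          intro j hj
          rw [Finset.mem_Icc] at hj
          have h1 := mul_nonneg (hQ j hj.1 hj.2) (hξ j hj.1 (by omega))
          have := mul_le_mul_of_nonneg_right (huV j hj.2) h1
          linarith
      _ = V * ∑ j ∈ Finset.Icc 1 (m+1), Q j * ξ j := by rw [Finset.mul_sum]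
      _ ≤ _ := mul_le_mul_of_nonneg_left (hG (m+1) (by omega) hi) hVpos.le
  have hT3 : ∑ j ∈ Finset.Icc 1 (m+1), Q j * (η j)^2 ≤ S ^ 2 := by
    calc _ ≤ ∑ j ∈ Finset.Icc 1 (m+1), (Q j * t j ^ (-α)) * M ^ 2 := by
          apply Finset.sum_le_sum
          intro j hj
          rw [Finset.mem_Icc] at hj
          rw [mul_assoc]
          apply mul_le_mul_of_nonneg_left _ (hQ j hj.1 hj.2)
          have htj := aux_pos N t ht0 htmono j hj.1 (by omega)
          have h1 := hM j hj.1 (by omega)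
          have h2 : 0 ≤ t j ^ (α/2) * η j :=
            mul_nonneg (Real.rpow_nonneg htj.le _) (hη j hj.1 (by omega))
          have h3 := pow_le_pow_left₀ h2 h1 2
          rw [mul_pow, ← Real.rpow_natCast (t j ^ (α/2)) 2, ← Real.rpow_mul htj.le] at h3
          have e : α / 2 * ((2:ℕ):ℝ) = α := by push_cast; ring
          rw [e] at h3
          have hp := Real.rpow_pos_of_pos htj α
          rw [Real.rpow_neg htj.le, inv_mul_eq_div, le_div_iff₀ hp]
          linarith
      _ = (∑ j ∈ Finset.Icc 1 (m+1), Q j * t j ^ (-α)) * M ^ 2 := by rw [Finset.sum_mul]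
      _ ≤ πA * Real.Gamma (1-α) * M ^ 2 := mul_le_mul_of_nonneg_right heta (by positivity)
      _ = _ := hS2.symm
  have hA0 := aux_A0 N α πA Λ τ hα0 hα1 hπA hΛ0 t htmono A hA2 hτ hτbound (m+1) (by omega) hmN
  have hQlast : Q (m+1) * Λ ≤ 1 / 2 := by
    simp only [hQdef, Nat.sub_self]
    have hp := hA1pos (m+1) (by omega) hmN
    rw [hP0 (m+1) (by omega) hmN, one_div_mul_eq_div, div_le_iff₀ hp]
    linarith
  have hT1 : ∑ j ∈ Finset.Icc 1 (m+1), Q j * ∑ k ∈ Finset.Icc 1 j, lam (j-k) * (u k)^2 ≤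
      V * (Ψ * (E (m+1) - 1)) + V * V / 2 := by
    rw [Finset.sum_Icc_succ_top (by omega)]
    apply add_le_add
    · calc _ ≤ ∑ j ∈ Finset.Icc 1 m, V * Ψ * (2 * Λ) * (Q j * E j) := by
            apply Finset.sum_le_sum
            intro j hj
            rw [Finset.mem_Icc] at hj
            have h1 := hlamB j (2 * E j * Ψ) (by omega) (fun k hk => huF k j hk hj.2)
            have h2 := mul_le_mul_of_nonneg_left h1 (hQ j hj.1 (by omega))
            linarith
        _ = V * Ψ * (2 * Λ * ∑ j ∈ Finset.Icc 1 m, Q j * E j) := by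
            rw [← Finset.mul_sum]; ring
        _ ≤ V * Ψ * (E (m+1) - 1) := mul_le_mul_of_nonneg_left hml2 (by positivity)
        _ = _ := by ring
    · have h1 := hlamB (m+1) V (le_refl _) huV
      have h2 := mul_le_mul_of_nonneg_left h1 (hQ (m+1) (by omega) (le_refl _))
      have h3 := mul_le_mul_of_nonneg_right hQlast (mul_nonneg hVpos.le hVpos.le)
      linarith
  have h4 : v 0 ^ 2 ≤ V * v 0 := by
    rw [sq]; exact mul_le_mul_of_nonneg_right (hvV 0 (by omega)) hv0
  have h5 : S ^ 2 ≤ V * S := by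
    rw [sq]; exact mul_le_mul_of_nonneg_right hVS.le hS0
  apply le_of_mul_le_mul_left _ hVpos
  have h6 : V * V ≤ V * Ψ + V * (Ψ * (E (m+1) - 1)) + V * V / 2 := by
    have : V * Ψ = V * v 0 + V * G + V * S := by rw [hΨ]; ring
    rw [sq V] at hsum
    linarith
  linarith

end Aux

/-- Improved discrete fractional Grönwall inequality. -/
theorem stmt_4 (N : ℕ) (hN : 1 ≤ N) (α ν πA ρ Λ τ T : ℝ)
    (hα0 : 0 < α) (hα1 : α < 1) (hν0 : 0 ≤ ν) (hν1 : ν < 1/2) (hπA : 0 < πA) (hρ : 0 < ρ)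
    (t : ℕ → ℝ) (ht0 : t 0 = 0) (htN : t N = T)
    (htmono : ∀ k : ℕ, 1 ≤ k → k ≤ N → t (k-1) < t k)
    (A P : ℕ → ℕ → ℝ)
    (hA1mono : ∀ n k : ℕ, 2 ≤ k → k ≤ n → n ≤ N → A n (k-1) ≤ A n (k-2) ∧ 0 < A n (k-1))
    (hA1first : ∀ n : ℕ, 2 ≤ n → n ≤ N → 0 ≤ (1 - 2*ν) * A n 0 - (1-ν) * A n 1)
    (hA1pos : ∀ n : ℕ, 1 ≤ n → n ≤ N → 0 < A n 0)
    (hA2 : ∀ n k : ℕ, 1 ≤ k → k ≤ n → n ≤ N →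
      (1 / (πA * (t k - t (k-1)))) *
        ∫ s in (t (k-1))..(t k), (t n - s) ^ (-α) / Real.Gamma (1-α) ≤ A n (n-k))
    (hA3 : ∀ k : ℕ, 1 ≤ k → k ≤ N - 1 → (t k - t (k-1)) / (t (k+1) - t k) ≤ ρ)
    (hP0 : ∀ n : ℕ, 1 ≤ n → n ≤ N → P n 0 = 1 / A n 0)
    (hPrec : ∀ n j : ℕ, 1 ≤ j → j + 1 ≤ n → n ≤ N →
      P n (n-j) = (1 / A j 0) *
        ∑ k ∈ Finset.Icc (j+1) n, (A k (k-j-1) - A k (k-j)) * P n (n-k))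
    (ξ η lam : ℕ → ℝ)
    (hξ : ∀ n : ℕ, 1 ≤ n → n ≤ N → 0 ≤ ξ n)
    (hη : ∀ n : ℕ, 1 ≤ n → n ≤ N → 0 ≤ η n)
    (hlam : ∀ l : ℕ, l ≤ N - 1 → 0 ≤ lam l)
    (hΛ : ∑ l ∈ Finset.range N, lam l ≤ Λ)
    (hτ : ∀ k : ℕ, 1 ≤ k → k ≤ N → t k - t (k-1) ≤ τ)
    (hτbound : τ ≤ (2 * πA * Real.Gamma (2-α) * Λ) ^ (-(1:ℝ)/α))
    (v : ℕ → ℝ) (hv : ∀ k : ℕ, k ≤ N → 0 ≤ v k)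
    (hineq : ∀ n : ℕ, 1 ≤ n → n ≤ N →
      ∑ k ∈ Finset.Icc 1 n, A n (n-k) * ((v k)^2 - (v (k-1))^2) ≤
        ∑ k ∈ Finset.Icc 1 n, lam (n-k) * (ν * v (k-1) + (1-ν) * v k)^2
          + (ν * v (n-1) + (1-ν) * v n) * ξ n + (η n)^2)
    (n : ℕ) (hn1 : 1 ≤ n) (hnN : n ≤ N) :
    v n ≤ 2 * (∑' i : ℕ, (2 * max 1 ρ * πA * Λ * t n ^ α) ^ i / Real.Gamma (1 + (i:ℝ) * α)) *
        (v 0 + (Finset.Icc 1 n).sup' (Finset.nonempty_Icc.mpr hn1)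
            (fun k => ∑ j ∈ Finset.Icc 1 k, P k (k-j) * ξ j)
          + Real.sqrt (πA * Real.Gamma (1-α)) *
            (Finset.Icc 1 n).sup' (Finset.nonempty_Icc.mpr hn1)
              (fun k => t k ^ (α/2) * η k)) := by
  have hΛnn : 0 ≤ Λ := le_trans (Finset.sum_nonneg fun l hl => hlam l (by
    rw [Finset.mem_range] at hl; omega)) hΛ
  have hΛ0 : 0 < Λ := by
    rcases hΛnn.lt_or_eq with h | h
    · exact h
    · exfalso
      rw [← h, mul_zero, Real.zero_rpow (div_ne_zero (by norm_num) hα0.ne')] at hτbound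
      have h1 := hτ 1 (le_refl _) hN
      have h2 := htmono 1 (le_refl _) hN
      linarith
  have hmem : (1:ℕ) ∈ Finset.Icc 1 n := by simp; omega
  apply aux_main N α ν πA ρ Λ τ hα0 hα1 hν0 hν1 hπA hρ t ht0 htmono A P hA1mono hA1pos hA2 hA3
    hP0 hPrec ξ η lam hξ hη hlam hΛ hΛ0 hτ hτbound v hv hineq n hnN _ _ _ _ _ _ n (le_refl _)
  · refine le_trans ?_ (Finset.le_sup' (fun k => ∑ j ∈ Finset.Icc 1 k, P k (k-j) * ξ j) hmem)
    have h1 := aux_P_nonneg N A P hA1mono hA1pos hP0 hPrec 1 hN _ 1 rfl (le_refl _) (le_refl _)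
    have h2 := hξ 1 (le_refl _) hN
    simpa using mul_nonneg h1 h2
  · refine le_trans ?_ (Finset.le_sup' (fun k => t k ^ (α/2) * η k) hmem)
    have h1 := aux_pos N t ht0 htmono 1 (le_refl _) hN
    exact mul_nonneg (Real.rpow_nonneg h1.le _) (hη 1 (le_refl _) hN)
  · intro k h1 h2
    exact Finset.le_sup' (fun k => ∑ j ∈ Finset.Icc 1 k, P k (k-j) * ξ j)
      (Finset.mem_Icc.mpr ⟨h1, h2⟩)
  · intro k h1 h2
    exact Finset.le_sup' (fun k => t k ^ (α/2) * η k) (Finset.mem_Icc.mpr ⟨h1, h2⟩)
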